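/- Under the feedback linearizing braking controller with constant designated slip λ_d, the slip error decays exponentially: with the hypotheses and definitions of the closed-loop wheel dynamics (ν′ = −g μ, J_w Ω′ = −B_f Ω + m g R μ − τ_B, ν(t) > 0, τ_B the feedback linearizing control with gain c > 0, λ̃ := (ν − R Ω)/ν − λ_d), for all t ≥ 0 one has λ̃(t) = λ̃(0) e^{−c t}. -/

import Mathlib

/-- A solution of `y′ = -c y` on `[0, ∞)` is `y 0 * exp (-(c * t))`. -/
theorem eq_mul_exp_neg_of_hasDerivAt {y : ℝ → ℝ} {c : ℝ}
    (hy : ∀ t : ℝ, 0 ≤ t → HasDerivAt y (-(c * y t)) t) {t : ℝ} (ht : 0 ≤ t) :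
    y t = y 0 * Real.exp (-(c * t)) := by
  have hderiv : ∀ s : ℝ, 0 ≤ s → HasDerivAt (fun s => y s * Real.exp (c * s)) 0 s := by
    intro s hs
    have hexp : HasDerivAt (fun s => Real.exp (c * s)) (Real.exp (c * s) * (c * 1)) s :=
      ((hasDerivAt_id s).const_mul c).exp
    exact ((hy s hs).mul hexp).congr_deriv (by ring)
  have hconst : y t * Real.exp (c * t) = y 0 * Real.exp (c * 0) :=
    constant_of_has_deriv_right_zero
      (fun s hs => (hderiv s hs.1).continuousAt.continuousWithinAt)
      (fun s hs => (hderiv s hs.1).hasDerivWithinAt) t ⟨ht, le_rfl⟩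
  rw [mul_zero, Real.exp_zero, mul_one] at hconst
  rw [← hconst, mul_assoc, ← Real.exp_add, add_neg_cancel, Real.exp_zero, mul_one]

/-- Under the feedback linearizing braking controller with constant designated
slip `λ_d`, the slip error decays exponentially: `λ̃(t) = λ̃(0) e^{−c t}` for
all `t ≥ 0`. -/
theorem abs_slip_error_exponential_decay
    (g R m Jw c : ℝ) (hg : 0 < g) (hR : 0 < R) (hm : 0 < m) (hJw : 0 < Jw)
    (hc : 0 < c) (Bf lamd : ℝ)
    (ν Ω μ : ℝ → ℝ)
    (hν : ∀ t : ℝ, 0 ≤ t → 0 < ν t)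
    (lam lamTilde τB : ℝ → ℝ)
    (hlam : ∀ t : ℝ, lam t = (ν t - R * Ω t) / ν t)
    (hlamTilde : ∀ t : ℝ, lamTilde t = lam t - lamd)
    (hτB : ∀ t : ℝ, τB t =
      -(c * Jw * ν t / R) * (lam t - lamd) - Bf * Ω t
        - (Jw * Ω t / ν t) * deriv ν t - m * R * deriv ν t)
    (hνdiff : ∀ t : ℝ, 0 ≤ t → HasDerivAt ν (-(g * μ t)) t)
    (hΩdiff : ∀ t : ℝ, 0 ≤ t →
      HasDerivAt Ω ((-(Bf * Ω t) + m * g * R * μ t - τB t) / Jw) t) :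
    ∀ t : ℝ, 0 ≤ t → lamTilde t = lamTilde 0 * Real.exp (-(c * t)) := by
  refine fun t ht => eq_mul_exp_neg_of_hasDerivAt (fun s hs => ?_) ht
  have hνs : ν s ≠ 0 := (hν s hs).ne'
  have hslip : lamTilde = fun s => (ν s - R * Ω s) / ν s - lamd := by
    funext s
    rw [hlamTilde, hlam]
  have hder := (((hνdiff s hs).sub ((hΩdiff s hs).const_mul R)).div
    (hνdiff s hs) hνs).sub_const lamd
  rw [hslip]
  refine hder.congr_deriv ?_
  simp only [Pi.sub_apply]
  rw [hτB, hlam, (hνdiff s hs).deriv]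
  field_simp
  ring
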